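/- Let β ∈ ℝ∖ℚ, q, r ∈ ℚ, and s ∈ ℝ. Then the limit lim_{N→∞} (1/N)·Σ_{n=1}^N e((q + βr)·n + {βn}·s) exists and equals I_q · I_r, where I_q = 1 if q ∈ ℤ and I_q = 0 otherwise, and where I_r = 0 if r ∉ ℤ; I_r = 1 if r ∈ ℤ and r = −s; I_r = 0 if r ∈ ℤ and r + s ∈ ℤ∖{0}; and I_r = (e(r+s) − 1)/(2πi(r+s)) if r ∈ ℤ and r + s ∉ ℤ. In particular the limit is 0 if and only if q ∉ ℤ, or r ∉ ℤ, or r + s ∈ ℤ∖{0}. -/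

import Mathlib

open Filter Finset
open scoped Classical

noncomputable section

/-- `e(x) = exp(2πix)`. -/
def e (x : ℝ) : ℂ := Complex.exp (2 * (Real.pi : ℂ) * Complex.I * (x : ℂ))

/-- The indicator (in `ℂ`) of a proposition. -/
def ind (P : Prop) : ℂ := if P then 1 else 0

/-- The factor `I_r`: `0` if `r ∉ ℤ`; `1` if `r ∈ ℤ` and `r = −s`; `0` if `r ∈ ℤ` and
`r + s ∈ ℤ∖{0}`; `(e(r+s) − 1)/(2πi(r+s))` if `r ∈ ℤ` and `r + s ∉ ℤ`. -/
def Ifac (r : ℚ) (s : ℝ) : ℂ :=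
  if ¬ ∃ m : ℤ, (m : ℚ) = r then 0
  else if (r : ℝ) = -s then 1
  else if ∃ m : ℤ, m ≠ 0 ∧ (m : ℝ) = (r : ℝ) + s then 0
  else (e ((r : ℝ) + s) - 1) / (2 * (Real.pi : ℂ) * Complex.I * (((r : ℝ) + s : ℝ) : ℂ))

theorem e_add (x y : ℝ) : e (x + y) = e x * e y := by
  simp only [e, ← Complex.exp_add]
  push_cast
  ring_nf

theorem norm_e (x : ℝ) : ‖e x‖ = 1 := by
  rw [e, show 2 * (Real.pi : ℂ) * Complex.I * (x : ℂ) = ((2 * Real.pi * x : ℝ) : ℂ) * Complex.I by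
    push_cast; ring]
  exact Complex.norm_exp_ofReal_mul_I _

theorem e_eq_one_iff (x : ℝ) : e x = 1 ↔ ∃ m : ℤ, (m : ℝ) = x := by
  rw [e, Complex.exp_eq_one_iff]
  refine exists_congr fun m => ?_
  rw [mul_comm, mul_left_inj' Complex.two_pi_I_ne_zero, eq_comm]
  norm_cast

theorem e_intCast (m : ℤ) : e m = 1 := (e_eq_one_iff _).2 ⟨m, rfl⟩

@[fun_prop]
theorem continuous_e : Continuous e := by
  unfold e
  fun_prop

theorem e_mul_natCast (x : ℝ) (n : ℕ) : e (x * n) = e x ^ n := by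
  rw [e, e, ← Complex.exp_nat_mul]
  push_cast
  ring_nf

theorem integral_e_mul {x : ℝ} (hx : x ≠ 0) :
    ∫ t in (0 : ℝ)..1, e (x * t) = (e x - 1) / (2 * (Real.pi : ℂ) * Complex.I * (x : ℂ)) := by
  have h := integral_exp_mul_complex (a := 0) (b := 1)
    (mul_ne_zero Complex.two_pi_I_ne_zero (Complex.ofReal_ne_zero.2 hx))
  simpa [e, mul_assoc] using h

/-- The average of `f` over `1, …, N`. -/
def average (f : ℕ → ℂ) (N : ℕ) : ℂ := (N : ℂ)⁻¹ * ∑ n ∈ Finset.Icc 1 N, f n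

theorem norm_average_le {f : ℕ → ℂ} {g : ℕ → ℝ} (h : ∀ n, ‖f n‖ ≤ g n) (N : ℕ) :
    ‖average f N‖ ≤ (N : ℝ)⁻¹ * ∑ n ∈ Finset.Icc 1 N, g n := by
  rw [average, norm_mul, norm_inv, Complex.norm_natCast]
  gcongr
  exact norm_sum_le_of_le _ fun n _ => h n

theorem norm_average_le_of_forall_norm_le {f : ℕ → ℂ} {C : ℝ} (hC : 0 ≤ C) (h : ∀ n, ‖f n‖ ≤ C)
    (N : ℕ) : ‖average f N‖ ≤ C := by
  refine (norm_average_le h N).trans ?_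
  rcases Nat.eq_zero_or_pos N with rfl | hN
  · simpa using hC
  · have : (N : ℝ) ≠ 0 := by positivity
    simp [this]

theorem average_sub (f g : ℕ → ℂ) (N : ℕ) :
    average f N - average g N = average (fun n => f n - g n) N := by
  simp [average, mul_sub]

theorem average_add (f g : ℕ → ℂ) (N : ℕ) :
    average (fun n => f n + g n) N = average f N + average g N := by
  simp [average, mul_add, Finset.sum_add_distrib]

theorem average_const_mul (a : ℂ) (f : ℕ → ℂ) (N : ℕ) :
    average (fun n => a * f n) N = a * average f N := by
  simp only [average, ← Finset.mul_sum]
  ring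

theorem tendsto_average_e (x : ℝ) :
    Tendsto (average fun n => e (x * n)) atTop (nhds (ind (∃ m : ℤ, (m : ℝ) = x))) := by
  by_cases hx : ∃ m : ℤ, (m : ℝ) = x
  · have h1 := (e_eq_one_iff x).2 hx
    rw [ind, if_pos hx]
    refine tendsto_const_nhds.congr' ?_
    filter_upwards [eventually_ne_atTop 0] with N hN
    have : (N : ℂ) ≠ 0 := by exact_mod_cast hN
    simp [average, e_mul_natCast, h1, this]
  · have h1 : e x - 1 ≠ 0 := sub_ne_zero.2 fun h => hx ((e_eq_one_iff x).1 h)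
    rw [ind, if_neg hx]
    have hb (N : ℕ) : ‖average (fun n => e (x * n)) N‖ ≤ (N : ℝ)⁻¹ * (2 / ‖e x - 1‖) := by
      rw [average, norm_mul, norm_inv, Complex.norm_natCast]
      gcongr
      have hs : (∑ n ∈ Finset.Icc 1 N, e (x * n)) * (e x - 1) = e x * (e x ^ N - 1) := by
        simp only [e_mul_natCast]
        rw [← geom_sum_mul, ← Finset.Ico_add_one_right_eq_Icc, Finset.sum_Ico_eq_sum_range,
          ← mul_assoc, Finset.mul_sum]
        simp [pow_add]
      rw [le_div_iff₀ (norm_pos_iff.2 h1), ← norm_mul, hs, norm_mul, norm_e, one_mul]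
      refine (norm_sub_le _ _).trans ?_
      rw [norm_pow, norm_e]
      norm_num
    refine squeeze_zero_norm hb ?_
    simpa using (tendsto_inv_atTop_nhds_zero_nat (𝕜 := ℝ)).mul_const (2 / ‖e x - 1‖)

theorem tendsto_of_forall_approx {a : ℕ → ℂ} {l : ℂ}
    (h : ∀ ε > 0, ∃ (b : ℕ → ℂ) (k : ℂ), Tendsto b atTop (nhds k) ∧ ‖l - k‖ ≤ ε ∧
      ∀ᶠ N in atTop, ‖a N - b N‖ ≤ ε) : Tendsto a atTop (nhds l) := by
  rw [Metric.tendsto_nhds]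
  intro ε hε
  obtain ⟨b, k, hb, hk, hab⟩ := h (ε / 4) (by positivity)
  filter_upwards [hab, Metric.tendsto_nhds.1 hb (ε / 4) (by positivity)] with N h1 h2
  rw [dist_eq_norm] at *
  have h3 : a N - l = (a N - b N) + (b N - k) - (l - k) := by ring
  rw [h3]
  have h4 := norm_sub_le (a N - b N + (b N - k)) (l - k)
  have h5 := norm_add_le (a N - b N) (b N - k)
  linarith

theorem continuous_circle_comp_coe_mul_e (f : C(AddCircle (1 : ℝ), ℂ)) (y : ℝ) :
    Continuous fun x : ℝ => f (x : AddCircle (1 : ℝ)) * e (y * x) := by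
  have : Continuous fun x : ℝ => (x : AddCircle (1 : ℝ)) := AddCircle.continuous_mk' 1
  fun_prop

theorem fourier_coe_eq_e (k : ℤ) (x : ℝ) :
    fourier k (x : AddCircle (1 : ℝ)) = e (k * x) := by
  rw [fourier_coe_apply, e]
  push_cast
  ring_nf

/-- Weyl's criterion with a twist: if the limits hold on characters, they hold for continuous
functions on the circle. -/
theorem tendsto_average_circle {α β y : ℝ} {c : ℂ} (hc : ‖c‖ ≤ 1)
    (h : ∀ k : ℤ, Tendsto (average fun n => e ((α + k * β) * n)) atTop
      (nhds (c * ∫ x in (0 : ℝ)..1, e ((k + y) * x)))) (f : C(AddCircle (1 : ℝ), ℂ)) :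
    Tendsto (average fun n => e (α * n) * f ((β * n : ℝ) : AddCircle (1 : ℝ))) atTop
      (nhds (c * ∫ x in (0 : ℝ)..1, f (x : AddCircle (1 : ℝ)) * e (y * x))) := by
  have hfi (f : C(AddCircle (1 : ℝ), ℂ)) :=
    (continuous_circle_comp_coe_mul_e f y).intervalIntegrable (μ := MeasureTheory.volume) 0 1
  have hspan : ∀ g ∈ Submodule.span ℂ (Set.range <| @fourier (1 : ℝ)),
      Tendsto (average fun n => e (α * n) * g ((β * n : ℝ) : AddCircle (1 : ℝ))) atTop
      (nhds (c * ∫ x in (0 : ℝ)..1, g (x : AddCircle (1 : ℝ)) * e (y * x))) := by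
    intro g hg
    induction hg using Submodule.span_induction with
    | mem g hg =>
      obtain ⟨k, rfl⟩ := hg
      convert h k using 2
      · ext n
        rw [fourier_coe_eq_e, ← e_add]
        ring_nf
      · congr 2
        ext x
        rw [fourier_coe_eq_e, ← e_add]
        ring_nf
    | zero =>
      have h0 : (average fun _ => 0) = fun _ => 0 := by
        ext
        simp [average]
      simp [h0]
    | add g₁ g₂ _ _ h₁ h₂ =>
      simp only [ContinuousMap.add_apply, mul_add, add_mul]
      rw [intervalIntegral.integral_add (hfi g₁) (hfi g₂), mul_add]
      exact (h₁.add h₂).congr fun N => (average_add _ _ N).symm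
    | smul a g _ hg =>
      simp only [ContinuousMap.smul_apply, smul_eq_mul, mul_assoc, mul_left_comm _ a]
      rw [intervalIntegral.integral_const_mul, mul_left_comm]
      exact (hg.const_mul a).congr fun N => (average_const_mul _ _ N).symm
  have hf : f ∈ (Submodule.span ℂ (Set.range <| @fourier (1 : ℝ))).topologicalClosure := by
    rw [span_fourier_closure_eq_top]
    trivial
  refine tendsto_of_forall_approx fun ε hε => ?_
  obtain ⟨g, hg, hfg⟩ := Metric.mem_closure_iff.1 hf ε hε
  have hn (t : AddCircle (1 : ℝ)) : ‖f t - g t‖ ≤ ε := by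
    rw [← dist_eq_norm]
    exact (ContinuousMap.dist_apply_le_dist t).trans hfg.le
  refine ⟨_, _, hspan g hg, ?_, Eventually.of_forall fun N => ?_⟩
  · rw [← mul_sub, ← intervalIntegral.integral_sub (hfi f) (hfi g), norm_mul]
    have := intervalIntegral.norm_integral_le_of_norm_le_const (a := 0) (b := 1) (C := ε)
      (f := fun x : ℝ => f (x : AddCircle (1 : ℝ)) * e (y * x) - g x * e (y * x)) fun x _ => by
        rw [← sub_mul, norm_mul, norm_e, mul_one]
        exact hn x
    rw [sub_zero, abs_one, mul_one] at this
    exact (mul_le_of_le_one_left (norm_nonneg _) hc).trans this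
  · rw [average_sub]
    refine norm_average_le_of_forall_norm_le hε.le (fun n => ?_) N
    rw [← mul_sub, norm_mul, norm_e, one_mul]
    exact hn _

theorem tendsto_average_fract_of_eq {α β y : ℝ} {c : ℂ} (hc : ‖c‖ ≤ 1)
    (h : ∀ k : ℤ, Tendsto (average fun n => e ((α + k * β) * n)) atTop
      (nhds (c * ∫ x in (0 : ℝ)..1, e ((k + y) * x)))) {G : ℝ → ℂ} (hG : Continuous G)
    (hG1 : G 0 = G 1) :
    Tendsto (average fun n => e (α * n) * G (Int.fract (β * n))) atTop
      (nhds (c * ∫ x in (0 : ℝ)..1, G x * e (y * x))) := by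
  have hlift : Continuous (AddCircle.liftIco (1 : ℝ) 0 G) :=
    AddCircle.liftIco_zero_continuous hG1 hG.continuousOn
  have hval {x : ℝ} (hx : x ∈ Set.Ico (0 : ℝ) 1) :
      AddCircle.liftIco (1 : ℝ) 0 G (x : AddCircle (1 : ℝ)) = G x :=
    AddCircle.liftIco_zero_coe_apply hx
  convert tendsto_average_circle hc h ⟨_, hlift⟩ using 2
  · ext n
    have : ((β * n : ℝ) : AddCircle (1 : ℝ)) = (Int.fract (β * n) : ℝ) := by
      rw [← Int.self_sub_floor, AddCircle.coe_sub, eq_comm, sub_eq_self,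
        AddCircle.coe_eq_zero_iff]
      exact ⟨⌊β * n⌋, by simp⟩
    rw [this, ContinuousMap.coe_mk, hval ⟨Int.fract_nonneg _, Int.fract_lt_one _⟩]
  · congr 1
    refine intervalIntegral.integral_congr_ae ?_
    filter_upwards [MeasureTheory.compl_mem_ae_iff.2 (Real.volume_singleton (a := 1))] with x hx1 hx
    rw [Set.uIoc_of_le zero_le_one] at hx
    rw [ContinuousMap.coe_mk, hval ⟨hx.1.le, lt_of_le_of_ne hx.2 hx1⟩]

theorem tendsto_integral_bump_pow :
    Tendsto (fun m : ℕ => ∫ x in (0 : ℝ)..1, (1 - x * (1 - x)) ^ m) atTop (nhds 0) := by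
  have := intervalIntegral.tendsto_integral_filter_of_dominated_convergence (a := 0) (b := 1)
    (μ := MeasureTheory.volume) (l := atTop) (F := fun (m : ℕ) (x : ℝ) => (1 - x * (1 - x)) ^ m)
    (f := fun _ => 0) (fun _ => 1) ?_ ?_ ?_ ?_
  · simpa using this
  · exact Eventually.of_forall fun m => by
      apply Continuous.aestronglyMeasurable; fun_prop
  · refine Eventually.of_forall fun m => Eventually.of_forall fun x hx => ?_
    rw [Set.uIoc_of_le zero_le_one] at hx
    rw [norm_pow, Real.norm_of_nonneg (by nlinarith [hx.1, hx.2])]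
    exact pow_le_one₀ (by nlinarith [hx.1, hx.2]) (by nlinarith [hx.1, hx.2])
  · simp
  · filter_upwards [MeasureTheory.compl_mem_ae_iff.2 (Real.volume_singleton (a := 1))] with x hx1 hx
    rw [Set.uIoc_of_le zero_le_one] at hx
    have hx2 : x < 1 := lt_of_le_of_ne hx.2 hx1
    exact tendsto_pow_atTop_nhds_zero_of_lt_one (by nlinarith [hx.1])
      (by nlinarith [mul_pos hx.1 (sub_pos.2 hx2)])

theorem ratCast_add_mul_eq_intCast_iff {β : ℝ} (hβ : Irrational β) (q r : ℚ) :
    (∃ m : ℤ, (m : ℝ) = q + β * r) ↔ (∃ m : ℤ, (m : ℚ) = q) ∧ r = 0 := by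
  constructor
  · rintro ⟨m, hm⟩
    have hr : r = 0 := by
      by_contra hr
      refine (hβ.mul_ratCast hr) ⟨m - q, ?_⟩
      push_cast
      linarith
    subst hr
    rw [Rat.cast_zero, mul_zero, add_zero] at hm
    exact ⟨⟨m, by exact_mod_cast hm⟩, rfl⟩
  · rintro ⟨⟨m, rfl⟩, rfl⟩
    exact ⟨m, by simp⟩

theorem integral_e_intCast_mul (k : ℤ) :
    ∫ x in (0 : ℝ)..1, e (k * x) = if k = 0 then 1 else 0 := by
  split_ifs with hk
  · simp [hk, e]
  · rw [integral_e_mul (by exact_mod_cast hk), e_intCast]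
    simp

theorem tendsto_average_fract {α β y : ℝ} (hβ : Irrational β) {c : ℂ} (hc : ‖c‖ ≤ 1)
    (h : ∀ k : ℤ, Tendsto (average fun n => e ((α + k * β) * n)) atTop
      (nhds (c * ∫ x in (0 : ℝ)..1, e ((k + y) * x)))) {G : ℝ → ℂ} (hG : Continuous G)
    (hG1 : ∀ x, ‖G x‖ ≤ 1) :
    Tendsto (average fun n => e (α * n) * G (Int.fract (β * n))) atTop
      (nhds (c * ∫ x in (0 : ℝ)..1, G x * e (y * x))) := by
  refine tendsto_of_forall_approx fun ε hε => ?_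
  obtain ⟨m, hm⟩ := (tendsto_integral_bump_pow.eventually_lt_const hε).exists
  set b : ℝ → ℝ := fun x => (1 - x * (1 - x)) ^ m with hb
  have hbc : Continuous b := by fun_prop
  have hb0 (x : ℝ) : 0 ≤ b x := pow_nonneg (by nlinarith [sq_nonneg (x - 1 / 2)]) m
  have hGb (x : ℝ) : ‖G x * b x‖ ≤ b x := by
    rw [norm_mul, Complex.norm_real, Real.norm_of_nonneg (hb0 x)]
    exact mul_le_of_le_one_left (hb0 x) (hG1 x)
  have hbump : Tendsto (average fun n => e (0 * n) * (b (Int.fract (β * n)) : ℂ)) atTop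
      (nhds (1 * ∫ x in (0 : ℝ)..1, (b x : ℂ) * e (0 * x))) := by
    refine tendsto_average_fract_of_eq (by simp) (fun k => ?_) (G := fun x => (b x : ℂ))
      (by fun_prop) (by simp [hb])
    convert tendsto_average_e _ using 2
    have := ratCast_add_mul_eq_intCast_iff hβ 0 k
    rw [add_zero, integral_e_intCast_mul, one_mul, ind]
    refine if_congr ?_ rfl rfl
    simpa [mul_comm, eq_comm, show ∃ m : ℤ, m = 0 from ⟨0, rfl⟩] using this.symm
  have hbump' : Tendsto (fun N : ℕ => (N : ℝ)⁻¹ * ∑ n ∈ Finset.Icc 1 N, b (Int.fract (β * n)))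
      atTop (nhds (∫ x in (0 : ℝ)..1, b x)) := by
    rw [← Filter.tendsto_ofReal_iff]
    have he : e 0 = 1 := by simp [e]
    simp only [zero_mul, he, one_mul, mul_one, intervalIntegral.integral_ofReal] at hbump
    exact hbump.congr fun N => by simp [average]
  refine ⟨_, _, tendsto_average_fract_of_eq hc h (G := fun x => G x * (1 - b x))
    (by fun_prop) (by simp [hb]), ?_, ?_⟩
  · rw [← mul_sub, ← intervalIntegral.integral_sub
      (Continuous.intervalIntegrable (by fun_prop) _ _)
      (Continuous.intervalIntegrable (by fun_prop) _ _), norm_mul]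
    refine (mul_le_of_le_one_left (norm_nonneg _) hc).trans (le_trans ?_ hm.le)
    refine intervalIntegral.norm_integral_le_of_norm_le zero_le_one
      (Eventually.of_forall fun x _ => ?_) (hbc.intervalIntegrable _ _)
    rw [← sub_mul, norm_mul, norm_e, mul_one, mul_sub, mul_one, sub_sub_cancel]
    exact hGb x
  · filter_upwards [hbump'.eventually_lt_const hm] with N hN
    rw [average_sub]
    refine (norm_average_le (fun n => ?_) N).trans hN.le
    rw [← mul_sub, norm_mul, norm_e, one_mul, mul_sub, mul_one, sub_sub_cancel]
    exact hGb _

theorem Ifac_of_forall_ne {r : ℚ} (hr : ¬ ∃ m : ℤ, (m : ℚ) = r) (s : ℝ) : Ifac r s = 0 := by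
  rw [Ifac, if_pos hr]

theorem Ifac_intCast (m : ℤ) (s : ℝ) : Ifac m s = ∫ x in (0 : ℝ)..1, e ((s + m) * x) := by
  rw [Ifac, if_neg (not_not.2 ⟨m, rfl⟩), Rat.cast_intCast]
  split_ifs with h1 h2
  · simp [h1, e]
  · obtain ⟨k, hk, hks⟩ := h2
    rw [add_comm s, ← hks, integral_e_intCast_mul, if_neg hk]
  · rw [add_comm s, integral_e_mul fun h => h1 (by linarith)]

theorem Ifac_eq_zero_iff (r : ℚ) (s : ℝ) :
    Ifac r s = 0 ↔ (¬ ∃ m : ℤ, (m : ℚ) = r) ∨ ∃ m : ℤ, m ≠ 0 ∧ (m : ℝ) = (r : ℝ) + s := by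
  by_cases h1 : ∃ m : ℤ, (m : ℚ) = r
  swap
  · simp [Ifac_of_forall_ne h1, h1]
  rw [Ifac, if_neg (not_not.2 h1), or_iff_right (not_not.2 h1)]
  split_ifs with h2 h3
  · simp only [one_ne_zero, false_iff]
    rintro ⟨m, hm, hms⟩
    rw [h2, neg_add_cancel] at hms
    exact hm (by exact_mod_cast hms)
  · simp [h3]
  · have hrs : (r : ℝ) + s ≠ 0 := fun h => h2 (by linarith)
    simp only [h3, iff_false]
    refine div_ne_zero (sub_ne_zero.2 fun h => ?_)
      (mul_ne_zero Complex.two_pi_I_ne_zero (Complex.ofReal_ne_zero.2 hrs))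
    obtain ⟨m, hm⟩ := (e_eq_one_iff _).1 h
    refine h3 ⟨m, ?_, hm⟩
    rintro rfl
    exact hrs (by simpa using hm.symm)

/-- For irrational `β`, rationals `q, r` and `s ∈ ℝ`, the averages
`(1/N)·Σ e((q + βr)n + {βn}s)` converge to `I_q·I_r`, and `I_q·I_r = 0` iff `q ∉ ℤ` or
`r ∉ ℤ` or `r + s ∈ ℤ∖{0}`. -/
theorem stmt6 (β : ℝ) (hβ : Irrational β) (q r : ℚ) (s : ℝ) :
    Tendsto (fun N : ℕ => (N : ℂ)⁻¹ * ∑ n ∈ Finset.Icc 1 N,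
        e (((q : ℝ) + β * (r : ℝ)) * n + Int.fract (β * n) * s)) atTop
      (nhds (ind (∃ m : ℤ, (m : ℚ) = q) * Ifac r s)) ∧
    (ind (∃ m : ℤ, (m : ℚ) = q) * Ifac r s = 0 ↔
      (¬ ∃ m : ℤ, (m : ℚ) = q) ∨ (¬ ∃ m : ℤ, (m : ℚ) = r) ∨
        ∃ m : ℤ, m ≠ 0 ∧ (m : ℝ) = (r : ℝ) + s) := by
  refine ⟨?_, ?_⟩
  · have key (k : ℤ) : Tendsto (average fun n => e (((q : ℝ) + β * r + k * β) * n)) atTop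
        (nhds (ind ((∃ m : ℤ, (m : ℚ) = q) ∧ r + k = 0))) := by
      rw [← ratCast_add_mul_eq_intCast_iff hβ]
      convert tendsto_average_e _ using 3
      all_goals push_cast; ring_nf
    have hGc : Continuous fun x : ℝ => e (x * s) := by fun_prop
    have hG1 (x : ℝ) : ‖e (x * s)‖ ≤ 1 := (norm_e _).le
    by_cases hr : ∃ m : ℤ, (m : ℚ) = r
    · obtain ⟨m, rfl⟩ := hr
      have hc : ‖ind (∃ m : ℤ, (m : ℚ) = q)‖ ≤ 1 := by
        unfold ind
        split_ifs <;> simp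
      have := tendsto_average_fract (α := q + β * (m : ℚ)) (y := m) hβ hc (fun k => ?_) hGc hG1
      · convert this using 2
        · simp only [average, e_add]
        · rw [Ifac_intCast]
          congr 2
          ext x
          rw [← e_add]
          ring_nf
      · convert key k using 2
        rw [← Int.cast_add, integral_e_intCast_mul]
        have : (m : ℚ) + k = 0 ↔ k + m = 0 := by
          rw [add_comm]
          exact_mod_cast Iff.rfl
        simp only [ind, this]
        split_ifs <;> simp_all
    · have := tendsto_average_fract (α := q + β * r) (y := 0) (c := 0) hβ (by simp) (fun k => ?_) hGc hG1
      · rw [Ifac_of_forall_ne hr, mul_zero]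
        rw [zero_mul] at this
        simp only [← e_add] at this
        exact this
      · convert key k using 2
        rw [ind, if_neg, zero_mul]
        rintro ⟨-, hk⟩
        exact hr ⟨-k, by push_cast; linarith⟩
  · rw [mul_eq_zero, Ifac_eq_zero_iff]
    simp [ind]

end
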